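/- For every infinite cardinal κ there exists a graph G such that for every cardinal λ with 2 ≤ λ ≤ κ, the graph G admits a λ-decomposition. -/

import Mathlib

universe u
open Cardinal

/-- `T` is a spanning tree of `G`: a connected, acyclic subgraph of `G`
containing all vertices of `G` (as `T` lives on the same vertex type `V`,
connectedness of `T` already makes it spanning). -/
def IsSpanningTree {V : Type u} (G T : SimpleGraph V) : Prop :=
  T ≤ G ∧ T.IsTree

/-- A λ-decomposition of `G`: a family of λ many spanning trees whose edge sets
partition the edge set of `G`. -/
def HasDecomposition {V : Type u} (G : SimpleGraph V) (lam : Cardinal.{u}) : Prop :=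
  ∃ (ι : Type u) (T : ι → SimpleGraph V), #ι = lam ∧
    (∀ i, IsSpanningTree G (T i)) ∧
    (Pairwise (fun i j => Disjoint (T i).edgeSet (T j).edgeSet)) ∧
    (⋃ i, (T i).edgeSet) = G.edgeSet

/-- A graph whose edges join each vertex `v ≠ r` to a vertex `p v` of smaller rank
is a tree. -/
theorem SimpleGraph.isTree_of_parent {V : Type*} (T : SimpleGraph V) (r : V) (p : V → V)
    (rank : V → ℕ) (adj_parent : ∀ v, v ≠ r → T.Adj v (p v) ∧ rank (p v) < rank v)
    (of_adj : ∀ u v, T.Adj u v → (u ≠ r ∧ v = p u) ∨ (v ≠ r ∧ u = p v)) : T.IsTree := by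
  have reach : ∀ n v, rank v = n → T.Reachable v r := by
    intro n
    induction n using Nat.strong_induction_on with
    | _ n ih =>
      intro v hv
      by_cases h : v = r
      · rw [h]
      · obtain ⟨hadj, hlt⟩ := adj_parent v h
        exact hadj.reachable.trans (ih _ (hv ▸ hlt) _ rfl)
  have : Nonempty V := ⟨r⟩
  refine ⟨⟨fun u v => (reach _ u rfl).trans (reach _ v rfl).symm⟩, ?_⟩
  intro a c hc
  classical
  obtain ⟨v, hv, hmax⟩ := c.support.toFinset.exists_max_image rank ⟨a, by simp⟩
  rw [List.mem_toFinset] at hv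
  have eq_parent : ∀ x, x ∈ c.support → T.Adj v x → x = p v := by
    intro x hx hadj
    rcases of_adj v x hadj with h | h
    · exact h.2
    · have h1 := (adj_parent x h.1).2
      have h2 := hmax x (by simpa using hx)
      rw [← h.2] at h1
      omega
  have hc' := hc.rotate hv
  have hsub : ∀ x, x ∈ (c.rotate v hv).support → x ∈ c.support := fun x hx => by
    simpa using hx
  refine hc'.snd_ne_penultimate ?_
  exact (eq_parent _ (hsub _ (SimpleGraph.Walk.getVert_mem_support _ _))
      (SimpleGraph.Walk.adj_snd hc'.not_nil)).trans
    (eq_parent _ (hsub _ (SimpleGraph.Walk.getVert_mem_support _ _))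
      (SimpleGraph.Walk.adj_penultimate hc'.not_nil).symm).symm

namespace ConeTree

variable {K ι : Type u}

/-- The cone over the rooted tree of finite words over `K`; the apex is `none`.
The parent of a nonempty word is its tail. -/
def cone (K : Type u) : SimpleGraph (Option (List K)) :=
  SimpleGraph.fromRel fun x y => ∃ w, x = some w ∧
    (y = none ∨ ∃ k t, w = k :: t ∧ y = some t)

open Classical in
/-- An edge colouring of the cone: `(colours g a b w).1` is the colour of the edge from `w` to
its tail (`none` if `w` is empty) and `(colours g a b w).2` that of the edge from `w` to the
apex. The child `g i :: t` gets both its edges coloured `i` if `t` is not yet incident with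
colour `i`; every other child gets the colours `a` and `b`. -/
noncomputable def colours (g : ι → K) (a b : ι) : List K → Option ι × ι
  | [] => (none, a)
  | k :: t =>
    if h : ∃ i, g i = k ∧ (colours g a b t).1 ≠ some i ∧ (colours g a b t).2 ≠ i then
      (some h.choose, h.choose)
    else (some a, b)

/-- The edges of the cone with colour `i`. -/
def colourClass (g : ι → K) (a b : ι) (i : ι) : SimpleGraph (Option (List K)) :=
  SimpleGraph.fromRel fun x y => ∃ w, x = some w ∧
    ((y = none ∧ (colours g a b w).2 = i) ∨
      ∃ k t, w = k :: t ∧ y = some t ∧ (colours g a b w).1 = some i)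

open Classical in
/-- The parent of a vertex in the colour class `i`, viewed as a tree rooted at the apex. -/
noncomputable def parent (g : ι → K) (a b : ι) (i : ι) : Option (List K) → Option (List K)
  | none => none
  | some w =>
    if (colours g a b w).2 = i then none
    else if (colours g a b w).1 = some i then some w.tail
    else some (g i :: w)

open Classical in
/-- A rank that decreases along `parent`. -/
noncomputable def rank (g : ι → K) (a b : ι) (i : ι) : Option (List K) → ℕ
  | none => 0
  | some w =>
    if (colours g a b w).2 = i then 1
    else if (colours g a b w).1 = some i then w.length + 3
    else 2

theorem colours_special {g : ι → K} (hg : g.Injective) {a b i : ι} {t : List K}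
    (h1 : (colours g a b t).1 ≠ some i) (h2 : (colours g a b t).2 ≠ i) :
    colours g a b (g i :: t) = (some i, i) := by
  have h : ∃ j, g j = g i ∧ (colours g a b t).1 ≠ some j ∧ (colours g a b t).2 ≠ j :=
    ⟨i, rfl, h1, h2⟩
  have hi : h.choose = i := hg h.choose_spec.1
  rw [colours, dif_pos h, hi]

theorem special_of_colours_eq {g : ι → K} {a b i : ι} (hab : a ≠ b) {k : K} {t : List K}
    (h1 : (colours g a b (k :: t)).1 = some i) (h2 : (colours g a b (k :: t)).2 = i) :
    k = g i ∧ (colours g a b t).1 ≠ some i ∧ (colours g a b t).2 ≠ i := by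
  rw [colours] at h1 h2
  split_ifs at h1 h2 with h
  · have hs := h.choose_spec
    dsimp only at h2
    rw [h2] at hs
    exact ⟨hs.1.symm, hs.2⟩
  · simp only [Option.some.injEq] at h1
    exact absurd (h1.trans h2.symm) hab

theorem colourClass_isTree {g : ι → K} (hg : g.Injective) {a b : ι} (hab : a ≠ b) (i : ι) :
    (colourClass g a b i).IsTree := by
  have of_rel : ∀ x y : Option (List K), (∃ w, x = some w ∧
      ((y = none ∧ (colours g a b w).2 = i) ∨
        ∃ k t, w = k :: t ∧ y = some t ∧ (colours g a b w).1 = some i)) →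
      (x ≠ none ∧ y = parent g a b i x) ∨ (y ≠ none ∧ x = parent g a b i y) := by
    rintro x y ⟨w, rfl, ⟨rfl, h⟩ | ⟨k, t, rfl, rfl, h⟩⟩
    · left; simp [parent, h]
    · by_cases h2 : (colours g a b (k :: t)).2 = i
      · obtain ⟨rfl, h3, h4⟩ := special_of_colours_eq hab h h2
        right; simp [parent, h3, h4]
      · left; simp [parent, h, h2]
  refine SimpleGraph.isTree_of_parent _ none (parent g a b i) (rank g a b i) ?_ ?_
  · rintro (_ | w) hw
    · exact absurd rfl hw
    by_cases h2 : (colours g a b w).2 = i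
    · simp [parent, rank, h2, colourClass]
    by_cases h1 : (colours g a b w).1 = some i
    · cases w with
      | nil => simp [colours] at h1
      | cons k t =>
        refine ⟨?_, ?_⟩
        · simp [parent, h1, h2, colourClass]
        · simp only [parent, rank, h1, h2, if_true, if_false, List.tail_cons, List.length_cons]
          split_ifs <;> omega
    · have hs := colours_special hg h1 h2
      simp [parent, rank, h1, h2, colourClass, hs]
  · rintro x y ⟨-, h | h⟩
    · exact of_rel x y h
    · exact (of_rel y x h).symm

theorem colourClass_le_cone (g : ι → K) (a b i : ι) : colourClass g a b i ≤ cone K := by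
  rintro x y ⟨hne, h⟩
  refine ⟨hne, h.imp ?_ ?_⟩ <;>
  · rintro ⟨w, hw, h | ⟨k, t, h, h', -⟩⟩
    · exact ⟨w, hw, Or.inl h.1⟩
    · exact ⟨w, hw, Or.inr ⟨k, t, h, h'⟩⟩

theorem exists_colourClass_adj (g : ι → K) (a b : ι) {x y : Option (List K)}
    (h : (cone K).Adj x y) : ∃ i, (colourClass g a b i).Adj x y := by
  have key : ∀ x y : Option (List K), x ≠ y →
      (∃ w, x = some w ∧ (y = none ∨ ∃ k t, w = k :: t ∧ y = some t)) →
      ∃ i, (colourClass g a b i).Adj x y := by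
    rintro x y hne ⟨w, rfl, rfl | ⟨k, t, rfl, rfl⟩⟩
    · exact ⟨_, hne, Or.inl ⟨w, rfl, Or.inl ⟨rfl, rfl⟩⟩⟩
    · obtain ⟨i, hi⟩ : ∃ i, (colours g a b (k :: t)).1 = some i := by
        rw [colours]; split_ifs <;> exact ⟨_, rfl⟩
      exact ⟨i, hne, Or.inl ⟨_, rfl, Or.inr ⟨k, t, rfl, rfl, hi⟩⟩⟩
  rcases h with ⟨hne, h | h⟩
  · exact key x y hne h
  · obtain ⟨i, hi⟩ := key y x hne.symm h
    exact ⟨i, hi.symm⟩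

theorem eq_of_colourClass_adj {g : ι → K} {a b i j : ι} {x y : Option (List K)}
    (hi : (colourClass g a b i).Adj x y) (hj : (colourClass g a b j).Adj x y) : i = j := by
  have cons_cons_ne : ∀ (k l : K) (t : List K), k :: l :: t ≠ t := fun k l t h => by
    have := congrArg List.length h
    simp only [List.length_cons] at this
    omega
  rcases x with _ | u <;> rcases y with _ | v <;>
    simp only [colourClass, SimpleGraph.fromRel_adj] at hi hj <;> grind

theorem hasDecomposition_cone (K : Type u) (lam : Cardinal.{u}) (h2 : 2 ≤ lam) (hK : lam ≤ #K) :
    HasDecomposition (cone K) lam := by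
  induction lam using Cardinal.inductionOn with
  | _ ι =>
  obtain ⟨g⟩ := Cardinal.le_def _ _ |>.mp hK
  obtain ⟨a, b, hab⟩ := Cardinal.two_le_iff.mp h2
  refine ⟨ι, colourClass g a b, rfl,
    fun i => ⟨colourClass_le_cone _ _ _ _, colourClass_isTree g.injective hab i⟩, ?_, ?_⟩
  · intro i j hij
    rw [Set.disjoint_left]
    intro e
    induction e with
    | _ x y =>
    intro hi hj
    exact hij (eq_of_colourClass_adj hi hj)
  · ext e
    induction e with
    | _ x y =>
    simp only [Set.mem_iUnion, SimpleGraph.mem_edgeSet]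
    exact ⟨fun ⟨i, hi⟩ => colourClass_le_cone _ _ _ i hi, exists_colourClass_adj g a b⟩

end ConeTree

/-- For every infinite cardinal κ there is a graph admitting a λ-decomposition for
every cardinal λ with 2 ≤ λ ≤ κ. -/
theorem exists_graph_with_many_decompositions (κ : Cardinal.{u}) (hκ : aleph0 ≤ κ) :
    ∃ (V : Type u) (G : SimpleGraph V), ∀ lam : Cardinal.{u},
      2 ≤ lam → lam ≤ κ → HasDecomposition G lam := by
  exact ⟨_, ConeTree.cone κ.out, fun lam h2 hle =>
    ConeTree.hasDecomposition_cone _ lam h2 (by rwa [Cardinal.mk_out])⟩
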